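/- arXiv:2603.16988 — 4 statements merged into one kernel-verified Lean document; each statement's English description precedes it below -/
import Mathlib

section
/- For every integer n ≥ 1, the n-th root-of-unity ray pool P_n in ℂ³ is KS-uncolorable if and only if 6 divides n. -/
open Complex

noncomputable def zeta (n : ℕ) : ℂ := Complex.exp (2 * Real.pi * Complex.I / n)

noncomputable def hermInner (v w : Fin 3 → ℂ) : ℂ :=
  ∑ k, (starRingEnd ℂ) (v k) * w k

abbrev Ray3 := Projectivization ℂ (Fin 3 → ℂ)

/-- Orthogonality of rays, tested on canonical representatives; this is
independent of the choice of representative since the Hermitian inner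
product scales by nonzero factors. -/
def RayOrtho (x y : Ray3) : Prop := hermInner x.rep y.rep = 0

/-- The n-th root-of-unity ray pool: rays admitting a representative all of
whose coordinates lie in {0} ∪ {ζ^k : 0 ≤ k < n}. -/
def pool (n : ℕ) : Set Ray3 :=
  {x | ∃ (v : Fin 3 → ℂ) (hv : v ≠ 0), Projectivization.mk ℂ v hv = x ∧
    ∀ k, v k = 0 ∨ ∃ j : ℕ, j < n ∧ v k = zeta n ^ j}

/-- A KS coloring of a set `S` of rays: (a) orthogonal exclusion; (b) every
triad contained in `S` has exactly one element colored `true`. -/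
def IsKSColoring (S : Set Ray3) (f : Ray3 → Bool) : Prop :=
  (∀ v ∈ S, ∀ w ∈ S, RayOrtho v w → f v = true → f w = false) ∧
  (∀ a ∈ S, ∀ b ∈ S, ∀ c ∈ S, a ≠ b → a ≠ c → b ≠ c →
    RayOrtho a b → RayOrtho a c → RayOrtho b c →
      ((f a = true ∧ f b = false ∧ f c = false) ∨
       (f a = false ∧ f b = true ∧ f c = false) ∨
       (f a = false ∧ f b = false ∧ f c = true)))

def KSUncolorable (S : Set Ray3) : Prop := ¬ ∃ f : Ray3 → Bool, IsKSColoring S f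

/-- Every coordinate of `v` is zero or an `n`-th root of unity. -/
def IsRootVec (n : ℕ) (v : Fin 3 → ℂ) : Prop := ∀ k, v k = 0 ∨ v k ^ n = 1

theorem hermInner_eq (v w : Fin 3 → ℂ) :
    hermInner v w = (starRingEnd ℂ) (v 0) * w 0 + (starRingEnd ℂ) (v 1) * w 1 +
      (starRingEnd ℂ) (v 2) * w 2 := by
  simp [hermInner, Fin.sum_univ_three]

theorem hermInner_smul (a b : ℂ) (v w : Fin 3 → ℂ) :
    hermInner (a • v) (b • w) = (starRingEnd ℂ) a * b * hermInner v w := by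
  simp only [hermInner_eq, Pi.smul_apply, smul_eq_mul, map_mul]
  ring

theorem hermInner_comm_zero {v w : Fin 3 → ℂ} (h : hermInner v w = 0) : hermInner w v = 0 := by
  have := congrArg (starRingEnd ℂ) h
  simp only [hermInner_eq, map_add, map_mul, Complex.conj_conj, map_zero] at this ⊢
  linear_combination this

theorem hermInner_comp_perm (σ : Equiv.Perm (Fin 3)) (v w : Fin 3 → ℂ) :
    hermInner (v ∘ σ) (w ∘ σ) = hermInner v w :=
  Equiv.sum_comp σ fun k => (starRingEnd ℂ) (v k) * w k

theorem hermInner_self (v : Fin 3 → ℂ) :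
    hermInner v v = ((normSq (v 0) + normSq (v 1) + normSq (v 2) : ℝ) : ℂ) := by
  push_cast
  simp only [hermInner_eq, Complex.normSq_eq_conj_mul_self]

theorem hermInner_self_ne_zero {v : Fin 3 → ℂ} (hv : v ≠ 0) : hermInner v v ≠ 0 := by
  intro h
  rw [hermInner_self, Complex.ofReal_eq_zero] at h
  have h0 := normSq_nonneg (v 0)
  have h1 := normSq_nonneg (v 1)
  have h2 := normSq_nonneg (v 2)
  refine hv (funext fun k => normSq_eq_zero.1 ?_)
  fin_cases k <;> simp only [Fin.zero_eta, Fin.mk_one, Fin.reduceFinMk] <;> linarith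

theorem rayOrtho_mk {v w : Fin 3 → ℂ} (hv : v ≠ 0) (hw : w ≠ 0) :
    RayOrtho (Projectivization.mk ℂ v hv) (Projectivization.mk ℂ w hw) ↔ hermInner v w = 0 := by
  obtain ⟨a, ha⟩ := Projectivization.exists_smul_eq_mk_rep ℂ v hv
  obtain ⟨b, hb⟩ := Projectivization.exists_smul_eq_mk_rep ℂ w hw
  rw [RayOrtho, ← ha, ← hb, Units.smul_def, Units.smul_def, hermInner_smul]
  simp

theorem mk_ne_mk_of_hermInner {v w : Fin 3 → ℂ} (hv : v ≠ 0) (hw : w ≠ 0)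
    (h : hermInner v w = 0) : Projectivization.mk ℂ v hv ≠ Projectivization.mk ℂ w hw := by
  intro e
  rw [← rayOrtho_mk hv hw, ← e, rayOrtho_mk] at h
  exact hermInner_self_ne_zero hv h

theorem mem_pool_iff {n : ℕ} (hn : 1 ≤ n) (x : Ray3) :
    x ∈ pool n ↔ ∃ (v : Fin 3 → ℂ) (hv : v ≠ 0), Projectivization.mk ℂ v hv = x ∧
      IsRootVec n v := by
  have hz : IsPrimitiveRoot (zeta n) n := Complex.isPrimitiveRoot_exp n (by omega)
  have key (z : ℂ) : (∃ j : ℕ, j < n ∧ z = zeta n ^ j) ↔ z ^ n = 1 := by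
    constructor
    · rintro ⟨j, -, rfl⟩
      rw [← pow_mul, mul_comm, pow_mul, hz.pow_eq_one, one_pow]
    · intro h
      have : NeZero n := ⟨by omega⟩
      obtain ⟨j, hj, e⟩ := hz.eq_pow_of_pow_eq_one h
      exact ⟨j, hj, e.symm⟩
  simp only [pool, Set.mem_ofPred_eq, key, IsRootVec]

theorem conj_mul_self_of_pow_eq_one {n : ℕ} (hn : 1 ≤ n) {z : ℂ} (h : z ^ n = 1) :
    (starRingEnd ℂ) z * z = 1 := by
  rw [Complex.conj_mul', Complex.norm_eq_one_of_pow_eq_one h (by omega)]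
  simp

theorem conj_mul_pow_eq_one {n : ℕ} {z w : ℂ} (hz : z ^ n = 1) (hw : w ^ n = 1) :
    ((starRingEnd ℂ) z * w) ^ n = 1 := by
  rw [mul_pow, ← map_pow, hz, hw]
  simp

/-- The quotient of two coordinates, expressed through the terms of the inner product. -/
theorem div_eq_of_conj_mul {n : ℕ} (hn : 1 ≤ n) {a b c d r : ℂ} (ha : a ^ n = 1) (hb : b ^ n = 1)
    (hc : c ^ n = 1) (h : (starRingEnd ℂ) b * d = r * ((starRingEnd ℂ) a * c)) :
    d / c = r * (b / a) := by
  have ha' := conj_mul_self_of_pow_eq_one hn ha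
  have hb' := conj_mul_self_of_pow_eq_one hn hb
  have hc' := conj_mul_self_of_pow_eq_one hn hc
  have ha0 : a ≠ 0 := right_ne_zero_of_mul_eq_one ha'
  have hc0 : c ≠ 0 := right_ne_zero_of_mul_eq_one hc'
  field_simp
  linear_combination a * b * h - a * d * hb' + r * b * c * ha'

theorem quadratic_of_unimodular_sum {n : ℕ} (hn : 1 ≤ n) {x y z : ℂ} (hx : x ^ n = 1)
    (hy : y ^ n = 1) (hz : z ^ n = 1) (h : x + y + z = 0) : y ^ 2 + y * x + x ^ 2 = 0 := by
  have hx' := conj_mul_self_of_pow_eq_one hn hx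
  have hy' := conj_mul_self_of_pow_eq_one hn hy
  have hz' := conj_mul_self_of_pow_eq_one hn hz
  have h' := congrArg (starRingEnd ℂ) h
  simp only [map_add, map_zero] at h'
  have e : x * y + y * z + z * x = 0 := by
    linear_combination x * y * z * h' - y * z * hx' - x * z * hy' - x * y * hz'
  linear_combination (x + y) * h - e

theorem sum_three_ne_zero {n : ℕ} (hn : 1 ≤ n) (h3 : ¬ 3 ∣ n) {x y z : ℂ} (hx : x ^ n = 1)
    (hy : y ^ n = 1) (hz : z ^ n = 1) : x + y + z ≠ 0 := by
  intro h
  have q := quadratic_of_unimodular_sum hn hx hy hz h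
  have hx0 : x ≠ 0 := right_ne_zero_of_mul_eq_one (conj_mul_self_of_pow_eq_one hn hx)
  have e3 : (y / x) ^ 3 = 1 := by
    field_simp
    linear_combination (y - x) * q
  have en : (y / x) ^ n = 1 := by rw [div_pow, hx, hy, div_one]
  have hd : orderOf (y / x) ∣ Nat.gcd n 3 :=
    Nat.dvd_gcd (orderOf_dvd_of_pow_eq_one en) (orderOf_dvd_of_pow_eq_one e3)
  rw [Nat.Coprime.gcd_eq_one (((Nat.Prime.coprime_iff_not_dvd Nat.prime_three).2 h3).symm),
    Nat.dvd_one, orderOf_eq_one_iff, div_eq_one_iff_eq hx0] at hd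
  subst hd
  have : 3 * y ^ 2 = 0 := by linear_combination q
  simp [hx0] at this

theorem sum_two_ne_zero {n : ℕ} (h2 : ¬ 2 ∣ n) {x y : ℂ} (hx : x ^ n = 1) (hy : y ^ n = 1) :
    x + y ≠ 0 := by
  intro h
  rw [eq_neg_of_add_eq_zero_left h, Odd.neg_pow (by rwa [← Nat.not_even_iff_odd, even_iff_two_dvd]),
    hy] at hx
  norm_num at hx

/-! ### Uncolorability when `6 ∣ n` -/

/-- The coloring rules, for a function on vectors with coordinates in `{0} ∪ μₙ`. -/
structure IsVecColoring (n : ℕ) (g : (Fin 3 → ℂ) → Prop) : Prop where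
  excl : ∀ v w, v ≠ 0 → w ≠ 0 → IsRootVec n v → IsRootVec n w → hermInner v w = 0 → g v → ¬ g w
  triad : ∀ u v w, u ≠ 0 → v ≠ 0 → w ≠ 0 → IsRootVec n u → IsRootVec n v → IsRootVec n w →
    hermInner u v = 0 → hermInner u w = 0 → hermInner v w = 0 → g u ∨ g v ∨ g w

theorem IsVecColoring.comp_perm {n : ℕ} {g : (Fin 3 → ℂ) → Prop} (h : IsVecColoring n g)
    (σ : Equiv.Perm (Fin 3)) : IsVecColoring n fun v => g (v ∘ σ) := by
  have h0 {v : Fin 3 → ℂ} (hv : v ≠ 0) : v ∘ σ ≠ 0 := fun e =>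
    hv (funext fun k => by simpa using congrFun e (σ.symm k))
  have hr {v : Fin 3 → ℂ} (hv : IsRootVec n v) : IsRootVec n (v ∘ σ) := fun k => hv (σ k)
  constructor
  · intro v w hv hw rv rw' o
    exact h.excl _ _ (h0 hv) (h0 hw) (hr rv) (hr rw') (by rwa [hermInner_comp_perm])
  · intro u v w hu hv hw ru rv rw' o1 o2 o3
    exact h.triad _ _ _ (h0 hu) (h0 hv) (h0 hw) (hr ru) (hr rv) (hr rw')
      (by rwa [hermInner_comp_perm]) (by rwa [hermInner_comp_perm]) (by rwa [hermInner_comp_perm])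

theorem IsKSColoring.isVecColoring {n : ℕ} (hn : 1 ≤ n) {f : Ray3 → Bool}
    (hf : IsKSColoring (pool n) f) :
    IsVecColoring n fun v => ∃ hv : v ≠ 0, f (Projectivization.mk ℂ v hv) = true := by
  have hp {v : Fin 3 → ℂ} (hv : v ≠ 0) (rv : IsRootVec n v) :
      Projectivization.mk ℂ v hv ∈ pool n := (mem_pool_iff hn _).2 ⟨v, hv, rfl, rv⟩
  constructor
  · rintro v w hv hw rv rw' o ⟨_, h1⟩ ⟨_, h2⟩
    have := hf.1 _ (hp hv rv) _ (hp hw rw') ((rayOrtho_mk hv hw).2 o) h1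
    simp [h2] at this
  · intro u v w hu hv hw ru rv rw' o1 o2 o3
    rcases hf.2 _ (hp hu ru) _ (hp hv rv) _ (hp hw rw') (mk_ne_mk_of_hermInner hu hv o1)
      (mk_ne_mk_of_hermInner hu hw o2) (mk_ne_mk_of_hermInner hv hw o3)
      ((rayOrtho_mk hu hv).2 o1) ((rayOrtho_mk hu hw).2 o2) ((rayOrtho_mk hv hw).2 o3)
      with h | h | h
    · exact Or.inl ⟨hu, h.1⟩
    · exact Or.inr (Or.inl ⟨hv, h.2.1⟩)
    · exact Or.inr (Or.inr ⟨hw, h.2.2⟩)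

theorem IsVecColoring.false_of_first {n : ℕ} (hn : 6 ∣ n) {g : (Fin 3 → ℂ) → Prop}
    (h : IsVecColoring n g) (he : g ![1, 0, 0]) : False := by
  obtain ⟨w, hw, hcw⟩ : ∃ w : ℂ, w ^ 2 + w + 1 = 0 ∧ (starRingEnd ℂ) w = w ^ 2 := by
    have hp : IsPrimitiveRoot (Complex.exp (2 * Real.pi * Complex.I / (3 : ℕ))) 3 :=
      Complex.isPrimitiveRoot_exp 3 (by norm_num)
    set w := Complex.exp (2 * Real.pi * Complex.I / (3 : ℕ))
    have h3 : w ^ 3 = 1 := hp.pow_eq_one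
    refine ⟨w, ?_, ?_⟩
    · refine (mul_eq_zero.1 (?_ : (w - 1) * (w ^ 2 + w + 1) = 0)).resolve_left
        (sub_ne_zero.2 (hp.ne_one (by norm_num)))
      linear_combination h3
    · have := conj_mul_self_of_pow_eq_one (by norm_num) h3
      linear_combination w ^ 2 * this - (starRingEnd ℂ) w * h3
  have w3 : w ^ 3 = 1 := by linear_combination (w - 1) * hw
  have pn {z : ℂ} (hz : z ^ 6 = 1) : z ^ n = 1 := by
    obtain ⟨k, rfl⟩ := hn
    rw [pow_mul, hz, one_pow]
  have root {a b c : ℂ} (ha : a = 0 ∨ a ^ 6 = 1) (hb : b = 0 ∨ b ^ 6 = 1)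
      (hc : c = 0 ∨ c ^ 6 = 1) : IsRootVec n ![a, b, c] := by
    intro k
    fin_cases k
    · exact ha.imp_right pn
    · exact hb.imp_right pn
    · exact hc.imp_right pn
  have one6 : (1 : ℂ) = 0 ∨ (1 : ℂ) ^ 6 = 1 := Or.inr (one_pow 6)
  have zero6 : (0 : ℂ) = 0 ∨ (0 : ℂ) ^ 6 = 1 := Or.inl rfl
  have ne1 (b c : ℂ) : ![1, b, c] ≠ 0 := fun e => one_ne_zero (congrFun e 0)
  have neg6 {z : ℂ} (hz : z ^ 6 = 1) : (-z) ^ 6 = 1 := by rw [Even.neg_pow (by decide), hz]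
  have cs {z : ℂ} (hz : z ^ 6 = 1) : (starRingEnd ℂ) z * z = 1 :=
    conj_mul_self_of_pow_eq_one (by norm_num) hz
  have ne2 : ![(0 : ℂ), 1, 0] ≠ 0 := fun e => one_ne_zero (congrFun e 1)
  have ne3 : ![(0 : ℂ), 0, 1] ≠ 0 := fun e => one_ne_zero (congrFun e 2)
  have e2 : ¬ g ![0, 1, 0] := h.excl _ _ (ne1 0 0) ne2 (root one6 zero6 zero6)
    (root zero6 one6 zero6) (by simp [hermInner_eq]) he
  have e3 : ¬ g ![0, 0, 1] := h.excl _ _ (ne1 0 0) ne3 (root one6 zero6 zero6)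
    (root zero6 zero6 one6) (by simp [hermInner_eq]) he
  have hA {z : ℂ} (hz : z ^ 6 = 1) : g ![1, z, 0] ∨ g ![1, -z, 0] :=
    (h.triad ![0, 0, 1] ![1, z, 0] ![1, -z, 0] ne3 (ne1 _ _) (ne1 _ _) (root zero6 zero6 one6)
      (root one6 (Or.inr hz) zero6) (root one6 (Or.inr (neg6 hz)) zero6)
      (by simp [hermInner_eq]) (by simp [hermInner_eq])
      (by simp [hermInner_eq, cs hz])).resolve_left e3
  have hB {z : ℂ} (hz : z ^ 6 = 1) : g ![1, 0, z] ∨ g ![1, 0, -z] :=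
    (h.triad ![0, 1, 0] ![1, 0, z] ![1, 0, -z] ne2 (ne1 _ _) (ne1 _ _) (root zero6 one6 zero6)
      (root one6 zero6 (Or.inr hz)) (root one6 zero6 (Or.inr (neg6 hz)))
      (by simp [hermInner_eq]) (by simp [hermInner_eq])
      (by simp [hermInner_eq, cs hz])).resolve_left e2
  have hA' {z : ℂ} (hz : z ^ 6 = 1) : g ![1, z, 0] → ¬ g ![1, -z, 0] :=
    h.excl _ _ (ne1 _ _) (ne1 _ _) (root one6 (Or.inr hz) zero6)
      (root one6 (Or.inr (neg6 hz)) zero6) (by simp [hermInner_eq, cs hz])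
  have hB' {z : ℂ} (hz : z ^ 6 = 1) : g ![1, 0, z] → ¬ g ![1, 0, -z] :=
    h.excl _ _ (ne1 _ _) (ne1 _ _) (root one6 zero6 (Or.inr hz))
      (root one6 zero6 (Or.inr (neg6 hz))) (by simp [hermInner_eq, cs hz])
  have hC {a b : ℂ} (ha : a ^ 6 = 1) (hb : b ^ 6 = 1) (hg : g ![1, a, b]) :
      g ![1, a, 0] ∧ g ![1, 0, b] :=
    ⟨(hA ha).resolve_right (h.excl _ _ (ne1 _ _) (ne1 _ _) (root one6 (Or.inr ha) (Or.inr hb))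
        (root one6 (Or.inr (neg6 ha)) zero6) (by simp [hermInner_eq, cs ha]) hg),
      (hB hb).resolve_right (h.excl _ _ (ne1 _ _) (ne1 _ _) (root one6 (Or.inr ha) (Or.inr hb))
        (root one6 zero6 (Or.inr (neg6 hb))) (by simp [hermInner_eq, cs hb]) hg)⟩
  have m1 {a : ℂ} (ha : a ^ 6 = 1) : (a * w) ^ 6 = 1 := by
    rw [mul_pow, ha, show w ^ 6 = (w ^ 3) ^ 2 by ring, w3]; norm_num
  have m2 {a : ℂ} (ha : a ^ 6 = 1) : (a * w ^ 2) ^ 6 = 1 := by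
    rw [mul_pow, ha, show (w ^ 2) ^ 6 = (w ^ 3) ^ 4 by ring, w3]; norm_num
  have hT {a b : ℂ} (ha : a ^ 6 = 1) (hb : b ^ 6 = 1) :
      (g ![1, a, 0] ∧ g ![1, 0, b]) ∨ (g ![1, a * w, 0] ∧ g ![1, 0, b * w ^ 2]) ∨
        (g ![1, a * w ^ 2, 0] ∧ g ![1, 0, b * w]) := by
    refine (h.triad ![1, a, b] ![1, a * w, b * w ^ 2] ![1, a * w ^ 2, b * w] (ne1 _ _) (ne1 _ _)
      (ne1 _ _) (root one6 (Or.inr ha) (Or.inr hb)) (root one6 (Or.inr (m1 ha)) (Or.inr (m2 hb)))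
      (root one6 (Or.inr (m2 ha)) (Or.inr (m1 hb))) ?_ ?_ ?_).imp (hC ha hb)
      (Or.imp (hC (m1 ha) (m2 hb)) (hC (m2 ha) (m1 hb)))
    · simp [hermInner_eq]
      linear_combination w * cs ha + w ^ 2 * cs hb + hw
    · simp [hermInner_eq]
      linear_combination w ^ 2 * cs ha + w * cs hb + hw
    · simp [hermInner_eq, hcw]
      linear_combination w ^ 4 * cs ha + w ^ 5 * cs hb + hw + (w + w ^ 2) * w3
  have minority (G : ℂ → Prop) (hG : ∀ z, z ^ 6 = 1 → G z → ¬ G (-z)) :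
      ∃ s : ℂ, s ^ 6 = 1 ∧ ¬ (G s ∧ G (s * w)) ∧ ¬ (G s ∧ G (s * w ^ 2)) ∧
        ¬ (G (s * w) ∧ G (s * w ^ 2)) := by
    have o6 : (1 : ℂ) ^ 6 = 1 := one_pow 6
    have q0 := hG 1 o6
    have q1 := hG (1 * w) (m1 o6)
    have q2 := hG (1 * w ^ 2) (m2 o6)
    rw [← neg_mul] at q1 q2
    by_cases c : ¬ (G 1 ∧ G (1 * w)) ∧ ¬ (G 1 ∧ G (1 * w ^ 2)) ∧ ¬ (G (1 * w) ∧ G (1 * w ^ 2))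
    · exact ⟨1, o6, c⟩
    · exact ⟨-1, neg6 o6, by grind⟩
  obtain ⟨s, hs, s1, s2, s3⟩ := minority (fun z => g ![1, z, 0]) fun z hz => hA' hz
  obtain ⟨t, ht, t1, t2, t3⟩ := minority (fun z => g ![1, 0, z]) fun z hz => hB' hz
  have r0 := hT hs ht
  have r1 := hT hs (m1 ht)
  rw [show t * w * w ^ 2 = t by linear_combination t * w3,
    show t * w * w = t * w ^ 2 by ring] at r1
  grind

theorem ksUncolorable_pool_of_dvd {n : ℕ} (hn : 1 ≤ n) (h6 : 6 ∣ n) : KSUncolorable (pool n) := by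
  rintro ⟨f, hf⟩
  have h := hf.isVecColoring hn
  have root (a b c : ℂ) (ha : a = 0 ∨ a = 1) (hb : b = 0 ∨ b = 1) (hc : c = 0 ∨ c = 1) :
      IsRootVec n ![a, b, c] := by
    intro k
    fin_cases k
    · exact ha.imp_right fun e => by simp [e]
    · exact hb.imp_right fun e => by simp [e]
    · exact hc.imp_right fun e => by simp [e]
  rcases h.triad ![1, 0, 0] ![0, 1, 0] ![0, 0, 1] (fun e => one_ne_zero (congrFun e 0))
    (fun e => one_ne_zero (congrFun e 1)) (fun e => one_ne_zero (congrFun e 2))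
    (root _ _ _ (by simp) (by simp) (by simp)) (root _ _ _ (by simp) (by simp) (by simp))
    (root _ _ _ (by simp) (by simp) (by simp)) (by simp [hermInner_eq]) (by simp [hermInner_eq])
    (by simp [hermInner_eq]) with c | c | c
  · exact h.false_of_first h6 c
  · refine (h.comp_perm (Equiv.swap 0 1)).false_of_first h6 ?_
    have : ![(1 : ℂ), 0, 0] ∘ Equiv.swap (0 : Fin 3) 1 = ![0, 1, 0] := by
      ext k; fin_cases k <;> rfl
    simpa only [this] using c
  · refine (h.comp_perm (Equiv.swap 0 2)).false_of_first h6 ?_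
    have : ![(1 : ℂ), 0, 0] ∘ Equiv.swap (0 : Fin 3) 2 = ![0, 0, 1] := by
      ext k; fin_cases k <;> rfl
    simpa only [this] using c

/-! ### Colorings when `6 ∤ n` -/

theorem colorable_of_isVecColoring {n : ℕ} (hn : 1 ≤ n) {P : (Fin 3 → ℂ) → Prop}
    (hP : IsVecColoring n P) (hs : ∀ (c : ℂ) (v : Fin 3 → ℂ), c ≠ 0 → (P (c • v) ↔ P v)) :
    ¬ KSUncolorable (pool n) := by
  classical
  have hrep {v : Fin 3 → ℂ} (hv : v ≠ 0) : P (Projectivization.mk ℂ v hv).rep ↔ P v := by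
    obtain ⟨a, ha⟩ := Projectivization.exists_smul_eq_mk_rep ℂ v hv
    rw [← ha, Units.smul_def]
    exact hs _ _ a.ne_zero
  refine not_not.2 ⟨fun x => decide (P x.rep), ?_, ?_⟩
  · intro x hx y hy o
    obtain ⟨v, hv, rfl, rv⟩ := (mem_pool_iff hn _).1 hx
    obtain ⟨w, hw, rfl, rw'⟩ := (mem_pool_iff hn _).1 hy
    simpa [hrep] using hP.excl v w hv hw rv rw' ((rayOrtho_mk hv hw).1 o)
  · intro x hx y hy z hz _ _ _ o1 o2 o3
    obtain ⟨u, hu, rfl, ru⟩ := (mem_pool_iff hn _).1 hx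
    obtain ⟨v, hv, rfl, rv⟩ := (mem_pool_iff hn _).1 hy
    obtain ⟨w, hw, rfl, rw'⟩ := (mem_pool_iff hn _).1 hz
    rw [rayOrtho_mk] at o1 o2 o3
    have h1 := hP.excl u v hu hv ru rv o1
    have h2 := hP.excl u w hu hw ru rw' o2
    have h3 := hP.excl v w hv hw rv rw' o3
    have h4 := hP.triad u v w hu hv hw ru rv rw' o1 o2 o3
    simp only [hrep, decide_eq_true_eq, decide_eq_false_iff_not]
    tauto

/-- Parseval's identity for the first coordinate vector in an orthogonal basis of `ℂ³`. -/
theorem parseval_first {u v w : Fin 3 → ℂ} (hu : u ≠ 0) (hv : v ≠ 0) (hw : w ≠ 0)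
    (o1 : hermInner u v = 0) (o2 : hermInner u w = 0) (o3 : hermInner v w = 0) :
    normSq (u 0) / (normSq (u 0) + normSq (u 1) + normSq (u 2)) +
      normSq (v 0) / (normSq (v 0) + normSq (v 1) + normSq (v 2)) +
      normSq (w 0) / (normSq (w 0) + normSq (w 1) + normSq (w 2)) = 1 := by
  have nu := hermInner_self_ne_zero hu
  have nv := hermInner_self_ne_zero hv
  have nw := hermInner_self_ne_zero hw
  let b : Fin 3 → Fin 3 → ℂ := ![u, v, w]
  let A : Matrix (Fin 3) (Fin 3) ℂ := .of fun i k => (starRingEnd ℂ) (b i k)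
  let B : Matrix (Fin 3) (Fin 3) ℂ := .of fun k j => b j k / hermInner (b j) (b j)
  have hAB : A * B = 1 := by
    ext i j
    have : (A * B) i j = hermInner (b i) (b j) / hermInner (b j) (b j) := by
      simp only [Matrix.mul_apply, hermInner, Finset.sum_div, A, B, Matrix.of_apply, mul_div_assoc]
    rw [this]
    have p1 := hermInner_comm_zero o1
    have p2 := hermInner_comm_zero o2
    have p3 := hermInner_comm_zero o3
    fin_cases i <;> fin_cases j <;> simp [b, nu, nv, nw, o1, o2, o3, p1, p2, p3]
  have hBA : B * A = 1 := mul_eq_one_comm.1 hAB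
  have h := congrFun (congrFun hBA 0) 0
  simp only [Matrix.mul_apply, Fin.sum_univ_three, A, B, b, Matrix.of_apply, hermInner_self,
    Matrix.cons_val_zero, Matrix.cons_val_one, Matrix.cons_val, Matrix.one_apply_eq] at h
  apply Complex.ofReal_injective
  push_cast at h ⊢
  simp only [Complex.normSq_eq_conj_mul_self] at h ⊢
  linear_combination h

theorem IsRootVec.weight {n : ℕ} (hn : 1 ≤ n) {v : Fin 3 → ℂ} (h : IsRootVec n v) {p : ℝ}
    (hp : normSq (v 0) / (normSq (v 0) + normSq (v 1) + normSq (v 2)) = p) :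
    p = 0 ∨ (p = 1 ∧ v 0 ≠ 0 ∧ v 1 = 0 ∧ v 2 = 0) ∨
      (p = 1 / 2 ∧ v 0 ≠ 0 ∧ v 1 = 0 ∧ v 2 ≠ 0) ∨ (p = 1 / 2 ∧ v 0 ≠ 0 ∧ v 1 ≠ 0 ∧ v 2 = 0) ∨
      (p = 1 / 3 ∧ v 0 ≠ 0 ∧ v 1 ≠ 0 ∧ v 2 ≠ 0) := by
  have key (k : Fin 3) : v k = 0 ∧ normSq (v k) = 0 ∨ v k ≠ 0 ∧ normSq (v k) = 1 := by
    rcases h k with e | e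
    · exact Or.inl ⟨e, by simp [e]⟩
    · have h1 := conj_mul_self_of_pow_eq_one hn e
      rw [← Complex.normSq_eq_conj_mul_self, Complex.ofReal_eq_one] at h1
      exact Or.inr ⟨fun e0 => by simp [e0] at h1, h1⟩
  subst hp
  rcases key 0 with ⟨a, a'⟩ | ⟨a, a'⟩ <;> rcases key 1 with ⟨b, b'⟩ | ⟨b, b'⟩ <;>
    rcases key 2 with ⟨c, c'⟩ | ⟨c, c'⟩ <;> norm_num [a, a', b, b', c, c']

/-- In an orthogonal triad of such vectors the first coordinate is hit by one vector of support
size one, two of support size two, or three of full support. -/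
theorem triad_cases {n : ℕ} (hn : 1 ≤ n) {u v w : Fin 3 → ℂ} (hu : u ≠ 0) (hv : v ≠ 0) (hw : w ≠ 0)
    (ru : IsRootVec n u) (rv : IsRootVec n v) (rw' : IsRootVec n w)
    (o1 : hermInner u v = 0) (o2 : hermInner u w = 0) (o3 : hermInner v w = 0) :
    (∃ x ∈ ({u, v, w} : Set (Fin 3 → ℂ)), x 0 ≠ 0 ∧ x 1 = 0 ∧ x 2 = 0) ∨
    (∃ x ∈ ({u, v, w} : Set (Fin 3 → ℂ)), ∃ y ∈ ({u, v, w} : Set (Fin 3 → ℂ)),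
      hermInner x y = 0 ∧ x 0 ≠ 0 ∧ y 0 ≠ 0 ∧ (x 1 = 0 ∨ x 2 = 0) ∧ (y 1 = 0 ∨ y 2 = 0)) ∨
    (∀ x ∈ ({u, v, w} : Set (Fin 3 → ℂ)), ∀ k, x k ≠ 0) := by
  have hp := parseval_first hu hv hw o1 o2 o3
  simp only [Set.mem_insert_iff, Set.mem_singleton_iff, exists_eq_or_imp, exists_eq_left,
    forall_eq_or_imp, forall_eq, Fin.forall_fin_succ, Fin.succ_zero_eq_one, Fin.succ_one_eq_two,
    IsEmpty.forall_iff, and_true]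
  generalize hpu : normSq (u 0) / (normSq (u 0) + normSq (u 1) + normSq (u 2)) = p at hp
  generalize hpv : normSq (v 0) / (normSq (v 0) + normSq (v 1) + normSq (v 2)) = q at hp
  generalize hpw : normSq (w 0) / (normSq (w 0) + normSq (w 1) + normSq (w 2)) = r at hp
  have hp' := ru.weight hn hpu
  have hq' := rv.weight hn hpv
  have hr' := rw'.weight hn hpw
  clear hpu hpv hpw
  rcases hp' with rfl | ⟨rfl, a⟩ | ⟨rfl, a⟩ | ⟨rfl, a⟩ | ⟨rfl, a⟩ <;>
  rcases hq' with rfl | ⟨rfl, b⟩ | ⟨rfl, b⟩ | ⟨rfl, b⟩ | ⟨rfl, b⟩ <;>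
  rcases hr' with rfl | ⟨rfl, c⟩ | ⟨rfl, c⟩ | ⟨rfl, c⟩ | ⟨rfl, c⟩ <;>
  first
  | (exfalso; norm_num at hp; done)
  | simp_all

/-- `z` is the chosen one among the `m`-th roots of `z ^ m`. -/
def IsChosenRoot (m : ℕ) (z : ℂ) : Prop := Classical.epsilon (fun w : ℂ => w ^ m = z ^ m) = z

theorem isChosenRoot_zero {m : ℕ} (hm : m ≠ 0) : IsChosenRoot m 0 := by
  have h := Classical.epsilon_spec (p := fun w : ℂ => w ^ m = 0 ^ m) ⟨0, rfl⟩
  exact eq_zero_of_pow_eq_zero (h.trans (zero_pow hm))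

theorem IsChosenRoot.eq_of_pow_eq {m : ℕ} {x y : ℂ} (hx : IsChosenRoot m x)
    (hy : IsChosenRoot m y) (h : x ^ m = y ^ m) : x = y := by
  unfold IsChosenRoot at hx hy
  rw [← hx, ← hy, h]

theorem exists_isChosenRoot (m : ℕ) (x : ℂ) : ∃ z, z ^ m = x ^ m ∧ IsChosenRoot m z := by
  have := Classical.epsilon_spec (p := fun w : ℂ => w ^ m = x ^ m) ⟨x, rfl⟩
  exact ⟨_, this, by rw [IsChosenRoot, this]⟩

theorem IsRootVec.pow_eq_one {n : ℕ} {v : Fin 3 → ℂ} (h : IsRootVec n v) {k : Fin 3}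
    (hk : v k ≠ 0) : v k ^ n = 1 := (h k).resolve_left hk

theorem ortho_of_not_three_dvd {n : ℕ} (hn : 1 ≤ n) (h3 : ¬ 3 ∣ n) {v w : Fin 3 → ℂ}
    (rv : IsRootVec n v) (rw' : IsRootVec n w) (o : hermInner v w = 0) (hv : v 0 ≠ 0)
    (hw : w 0 ≠ 0) :
    (v 1 ≠ 0 ∧ w 1 ≠ 0 ∧ w 1 / w 0 = -(v 1 / v 0)) ∨
      (v 2 ≠ 0 ∧ w 2 ≠ 0 ∧ w 2 / w 0 = -(v 2 / v 0)) := by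
  rw [hermInner_eq] at o
  have t0 := conj_mul_pow_eq_one (rv.pow_eq_one hv) (rw'.pow_eq_one hw)
  by_cases h1 : v 1 ≠ 0 ∧ w 1 ≠ 0
  · by_cases h2 : v 2 ≠ 0 ∧ w 2 ≠ 0
    · exact absurd o (sum_three_ne_zero hn h3 t0
        (conj_mul_pow_eq_one (rv.pow_eq_one h1.1) (rw'.pow_eq_one h1.2))
        (conj_mul_pow_eq_one (rv.pow_eq_one h2.1) (rw'.pow_eq_one h2.2)))
    · have z2 : (starRingEnd ℂ) (v 2) * w 2 = 0 := by
        simpa [or_iff_not_imp_left] using h2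
      refine Or.inl ⟨h1.1, h1.2, ?_⟩
      rw [neg_eq_neg_one_mul]
      exact div_eq_of_conj_mul hn (rv.pow_eq_one hv) (rv.pow_eq_one h1.1) (rw'.pow_eq_one hw)
        (by linear_combination o - z2)
  · have z1 : (starRingEnd ℂ) (v 1) * w 1 = 0 := by
      simpa [or_iff_not_imp_left] using h1
    by_cases h2 : v 2 ≠ 0 ∧ w 2 ≠ 0
    · refine Or.inr ⟨h2.1, h2.2, ?_⟩
      rw [neg_eq_neg_one_mul]
      exact div_eq_of_conj_mul hn (rv.pow_eq_one hv) (rv.pow_eq_one h2.1) (rw'.pow_eq_one hw)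
        (by linear_combination o - z1)
    · have z2 : (starRingEnd ℂ) (v 2) * w 2 = 0 := by
        simpa [or_iff_not_imp_left] using h2
      rw [z1, z2] at o
      simp [hv, hw] at o

theorem colorable_of_not_three_dvd {n : ℕ} (hn : 1 ≤ n) (h3 : ¬ 3 ∣ n) :
    ¬ KSUncolorable (pool n) := by
  have neg_excl {x y : ℂ} (hx : x ≠ 0) (sx : IsChosenRoot 2 x) (sy : IsChosenRoot 2 y)
      (e : y = -x) : False := by
    have := sx.eq_of_pow_eq sy (by rw [e]; ring)
    exact hx (self_eq_neg.1 (this.trans e))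
  have neg_ex {x y : ℂ} (e : y = -x) : IsChosenRoot 2 x ∨ IsChosenRoot 2 y := by
    obtain ⟨z, hz, cz⟩ := exists_isChosenRoot 2 x
    rcases sq_eq_sq_iff_eq_or_eq_neg.1 hz with h | h
    · exact Or.inl (h ▸ cz)
    · exact Or.inr (by rw [e, ← h]; exact cz)
  have c0 : IsChosenRoot 2 0 := isChosenRoot_zero two_ne_zero
  refine colorable_of_isVecColoring hn (P := fun v => v 0 ≠ 0 ∧ (v 1 = 0 ∨ v 2 = 0) ∧
    IsChosenRoot 2 (v 1 / v 0) ∧ IsChosenRoot 2 (v 2 / v 0)) ⟨?_, ?_⟩ ?_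
  · rintro v w - - rv rw' o ⟨v0, -, v1, v2⟩ ⟨w0, -, w1, w2⟩
    rcases ortho_of_not_three_dvd hn h3 rv rw' o v0 w0 with ⟨a, -, e⟩ | ⟨a, -, e⟩
    · exact neg_excl (div_ne_zero a v0) v1 w1 e
    · exact neg_excl (div_ne_zero a v0) v2 w2 e
  · intro u v w hu hv hw ru rv rw' o1 o2 o3
    suffices h : ∃ x ∈ ({u, v, w} : Set (Fin 3 → ℂ)), x 0 ≠ 0 ∧ (x 1 = 0 ∨ x 2 = 0) ∧
        IsChosenRoot 2 (x 1 / x 0) ∧ IsChosenRoot 2 (x 2 / x 0) by simpa using h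
    have root : ∀ x ∈ ({u, v, w} : Set (Fin 3 → ℂ)), IsRootVec n x := by
      simp [ru, rv, rw']
    rcases triad_cases hn hu hv hw ru rv rw' o1 o2 o3 with
      ⟨x, hx, x0, x1, x2⟩ | ⟨x, hx, y, hy, o, x0, y0, sx, sy⟩ | h
    · exact ⟨x, hx, x0, Or.inl x1, by simpa [x1] using c0, by simpa [x2] using c0⟩
    · rcases ortho_of_not_three_dvd hn h3 (root x hx) (root y hy) o x0 y0 with
        ⟨a, b, e⟩ | ⟨a, b, e⟩
      · have x2 := sx.resolve_left a
        have y2 := sy.resolve_left b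
        rcases neg_ex e with c | c
        · exact ⟨x, hx, x0, sx, c, by simpa [x2] using c0⟩
        · exact ⟨y, hy, y0, sy, c, by simpa [y2] using c0⟩
      · have x2 := sx.resolve_right a
        have y2 := sy.resolve_right b
        rcases neg_ex e with c | c
        · exact ⟨x, hx, x0, sx, by simpa [x2] using c0, c⟩
        · exact ⟨y, hy, y0, sy, by simpa [y2] using c0, c⟩
    · have nu := h u (by simp)
      have nv := h v (by simp)
      rw [hermInner_eq] at o1
      exact absurd o1 (sum_three_ne_zero hn h3
        (conj_mul_pow_eq_one (ru.pow_eq_one (nu 0)) (rv.pow_eq_one (nv 0)))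
        (conj_mul_pow_eq_one (ru.pow_eq_one (nu 1)) (rv.pow_eq_one (nv 1)))
        (conj_mul_pow_eq_one (ru.pow_eq_one (nu 2)) (rv.pow_eq_one (nv 2))))
  · intro c v hc
    simp [hc, mul_div_mul_left]

theorem ortho_of_not_two_dvd {n : ℕ} (hn : 1 ≤ n) (h2 : ¬ 2 ∣ n) {v w : Fin 3 → ℂ}
    (rv : IsRootVec n v) (rw' : IsRootVec n w) (o : hermInner v w = 0) (hv : v 0 ≠ 0)
    (hw : w 0 ≠ 0) :
    v 1 ≠ 0 ∧ v 2 ≠ 0 ∧ (w 1 / w 0) ^ 2 + (w 1 / w 0) * (v 1 / v 0) + (v 1 / v 0) ^ 2 = 0 := by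
  rw [hermInner_eq] at o
  have t0 := conj_mul_pow_eq_one (rv.pow_eq_one hv) (rw'.pow_eq_one hw)
  by_cases h1 : v 1 ≠ 0 ∧ w 1 ≠ 0
  · have t1 := conj_mul_pow_eq_one (rv.pow_eq_one h1.1) (rw'.pow_eq_one h1.2)
    by_cases h2 : v 2 ≠ 0 ∧ w 2 ≠ 0
    · have t2 := conj_mul_pow_eq_one (rv.pow_eq_one h2.1) (rw'.pow_eq_one h2.2)
      have q := quadratic_of_unimodular_sum hn t0 t1 t2 o
      have ht : (starRingEnd ℂ) (v 0) * w 0 ≠ 0 := by simp [hv, hw]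
      have e := div_eq_of_conj_mul hn (rv.pow_eq_one hv) (rv.pow_eq_one h1.1) (rw'.pow_eq_one hw)
        (div_mul_cancel₀ ((starRingEnd ℂ) (v 1) * w 1) ht).symm
      refine ⟨h1.1, h2.1, ?_⟩
      rw [e]
      generalize (starRingEnd ℂ) (v 1) * w 1 = t at q
      generalize (starRingEnd ℂ) (v 0) * w 0 = s at q ht
      field_simp
      linear_combination (v 1) ^ 2 * q
    · have z2 : (starRingEnd ℂ) (v 2) * w 2 = 0 := by
        simpa [or_iff_not_imp_left] using h2
      rw [z2, add_zero] at o
      exact absurd o (sum_two_ne_zero ‹¬ 2 ∣ n› t0 t1)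
  · have z1 : (starRingEnd ℂ) (v 1) * w 1 = 0 := by
      simpa [or_iff_not_imp_left] using h1
    rw [z1, add_zero] at o
    by_cases h2 : v 2 ≠ 0 ∧ w 2 ≠ 0
    · exact absurd o (sum_two_ne_zero ‹¬ 2 ∣ n› t0
        (conj_mul_pow_eq_one (rv.pow_eq_one h2.1) (rw'.pow_eq_one h2.2)))
    · have z2 : (starRingEnd ℂ) (v 2) * w 2 = 0 := by
        simpa [or_iff_not_imp_left] using h2
      rw [z2] at o
      simp [hv, hw] at o

theorem colorable_of_not_two_dvd {n : ℕ} (hn : 1 ≤ n) (h2 : ¬ 2 ∣ n) :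
    ¬ KSUncolorable (pool n) := by
  refine colorable_of_isVecColoring hn (P := fun v => v 0 ≠ 0 ∧ ((v 1 = 0 ∧ v 2 = 0) ∨
    (v 1 ≠ 0 ∧ v 2 ≠ 0 ∧ IsChosenRoot 3 (v 1 / v 0)))) ⟨?_, ?_⟩ ?_
  · rintro v w - - rv rw' o ⟨v0, hv⟩ ⟨w0, hw⟩
    obtain ⟨v1, -, q⟩ := ortho_of_not_two_dvd hn h2 rv rw' o v0 w0
    obtain ⟨w1, -, -⟩ := ortho_of_not_two_dvd hn h2 rw' rv (hermInner_comm_zero o) w0 v0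
    obtain ⟨-, -, cv⟩ := hv.resolve_left fun h => v1 h.1
    obtain ⟨-, -, cw⟩ := hw.resolve_left fun h => w1 h.1
    have e := cw.eq_of_pow_eq cv (by linear_combination (w 1 / w 0 - v 1 / v 0) * q)
    rw [e] at q
    have : 3 * (v 1 / v 0) ^ 2 = 0 := by linear_combination q
    simp [v0, v1] at this
  · intro u v w hu hv hw ru rv rw' o1 o2 o3
    have root : ∀ x ∈ ({u, v, w} : Set (Fin 3 → ℂ)), IsRootVec n x := by
      simp [ru, rv, rw']
    rcases triad_cases hn hu hv hw ru rv rw' o1 o2 o3 with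
      ⟨x, hx, h⟩ | ⟨x, hx, y, hy, o, x0, y0, sx, -⟩ | h
    · simp only [Set.mem_insert_iff, Set.mem_singleton_iff] at hx
      rcases hx with rfl | rfl | rfl <;> simp [h]
    · obtain ⟨x1, x2, -⟩ := ortho_of_not_two_dvd hn h2 (root x hx) (root y hy) o x0 y0
      exact absurd sx (by simp [x1, x2])
    · have nu := h u (by simp)
      have nv := h v (by simp)
      have nw := h w (by simp)
      have q1 := (ortho_of_not_two_dvd hn h2 ru rv o1 (nu 0) (nv 0)).2.2
      have q2 := (ortho_of_not_two_dvd hn h2 ru rw' o2 (nu 0) (nw 0)).2.2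
      have q3 := (ortho_of_not_two_dvd hn h2 rv rw' o3 (nv 0) (nw 0)).2.2
      have ha : v 1 / v 0 ≠ 0 := div_ne_zero (nv 1) (nv 0)
      simp only [ne_eq, nu, nv, nw, not_false_eq_true, true_and, false_and, false_or]
      generalize u 1 / u 0 = x at *
      generalize v 1 / v 0 = y at *
      generalize w 1 / w 0 = z at *
      have hzy : z ≠ y := by
        rintro rfl
        have : 3 * z ^ 2 = 0 := by linear_combination q3
        simp [ha] at this
      have hs : z + y + x = 0 := by
        refine (mul_eq_zero.1 (?_ : (z - y) * (z + y + x) = 0)).resolve_left (sub_ne_zero.2 hzy)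
        linear_combination q2 - q1
      obtain ⟨r, hr, cr⟩ := exists_isChosenRoot 3 x
      have hm : (r - x) * ((r - y) * (r - z)) = 0 := by
        linear_combination hr - (r ^ 2 - r * x) * hs + (r - x) * (y * hs - q1)
      rcases mul_eq_zero.1 hm with e | e
      · exact Or.inl (sub_eq_zero.1 e ▸ cr)
      · rcases mul_eq_zero.1 e with e | e
        · exact Or.inr (Or.inl (sub_eq_zero.1 e ▸ cr))
        · exact Or.inr (Or.inr (sub_eq_zero.1 e ▸ cr))
  · intro c v hc
    simp [hc, mul_div_mul_left]

/-- The n-th root-of-unity ray pool in ℂ³ is KS-uncolorable iff 6 ∣ n. -/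
theorem stmt0 (n : ℕ) (hn : 1 ≤ n) : KSUncolorable (pool n) ↔ 6 ∣ n := by
  refine ⟨fun h => ?_, ksUncolorable_pool_of_dvd hn⟩
  by_contra h6
  by_cases h2 : 2 ∣ n
  · exact colorable_of_not_three_dvd hn (by omega) h
  · exact colorable_of_not_two_dvd hn h2 h
end

section
/- For an integer n ≥ 1 and ζ = exp(2πi/n), there exist integers a, b, c with ζ^a + ζ^b + ζ^c = 0 if and only if 3 divides n. -/
open Complex

theorem isPrimitiveRoot_zeta {n : ℕ} (hn : n ≠ 0) : IsPrimitiveRoot (zeta n) n :=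
  Complex.isPrimitiveRoot_exp n hn

/-- If `x`, `y`, `z` have norm one and sum to zero, then `y / x` is a root of `X ^ 2 + X + 1`,
stated here in homogeneous form. -/
theorem sq_add_mul_add_sq_eq_zero_of_norm_eq_one {x y z : ℂ} (hx : ‖x‖ = 1) (hy : ‖y‖ = 1)
    (hz : ‖z‖ = 1) (h : x + y + z = 0) : x ^ 2 + x * y + y ^ 2 = 0 := by
  have hconj : x⁻¹ + y⁻¹ + z⁻¹ = 0 := by
    rw [Complex.inv_eq_conj hx, Complex.inv_eq_conj hy, Complex.inv_eq_conj hz,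
      ← map_add, ← map_add, h, map_zero]
  have hx0 : x ≠ 0 := by rintro rfl; simp at hx
  have hy0 : y ≠ 0 := by rintro rfl; simp at hy
  have hz0 : z ≠ 0 := by rintro rfl; simp at hz
  field_simp at hconj
  linear_combination (x + y) * h - hconj

/-- There is a vanishing three-term sum of n-th roots of unity iff 3 ∣ n. -/
theorem stmt1 (n : ℕ) (hn : 1 ≤ n) :
    (∃ a b c : ℤ, zeta n ^ a + zeta n ^ b + zeta n ^ c = 0) ↔ 3 ∣ n := by
  have hn0 : n ≠ 0 := by omega
  have hζ := isPrimitiveRoot_zeta hn0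
  have hζ0 : zeta n ≠ 0 := hζ.ne_zero hn0
  constructor
  · rintro ⟨a, b, c, h⟩
    have hnorm (k : ℤ) : ‖zeta n ^ k‖ = 1 := by
      rw [norm_zpow, hζ.norm'_eq_one hn0, one_zpow]
    have hsq := sq_add_mul_add_sq_eq_zero_of_norm_eq_one (hnorm a) (hnorm b) (hnorm c) h
    have hb : zeta n ^ b = zeta n ^ a * zeta n ^ (b - a) := by
      rw [← zpow_add₀ hζ0]; congr 1; ring
    have ha0 : zeta n ^ a ≠ 0 := zpow_ne_zero a hζ0
    set w := zeta n ^ (b - a) with hw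
    have hw_sq : w ^ 2 + w + 1 = 0 := by
      rw [hb] at hsq
      apply mul_left_cancel₀ (pow_ne_zero 2 ha0)
      linear_combination hsq
    have hw_cube : w ^ 3 = 1 := by linear_combination (w - 1) * hw_sq
    have hw_ne : w ≠ 1 := by
      intro h1
      norm_num [h1] at hw_sq
    have hw_pow : w ^ n = 1 := by
      rw [hw, ← zpow_natCast, zpow_comm, zpow_natCast, hζ.pow_eq_one, one_zpow]
    have : Fact (Nat.Prime 3) := ⟨Nat.prime_three⟩
    rw [← orderOf_eq_prime hw_cube hw_ne]
    exact orderOf_dvd_of_pow_eq_one hw_pow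
  · rintro ⟨m, rfl⟩
    have hω : IsPrimitiveRoot (zeta (3 * m) ^ m) 3 := hζ.pow (by omega) (mul_comm 3 m)
    refine ⟨0, m, (m * 2 : ℕ), ?_⟩
    have hsum := hω.geom_sum_eq_zero (by norm_num)
    simp only [Finset.sum_range_succ, Finset.sum_range_zero] at hsum
    rw [zpow_zero, zpow_natCast, zpow_natCast, pow_mul]
    linear_combination hsum
end

section
/- Let n ≥ 1 be odd and ζ = exp(2πi/n). Then no ray of the n-th root-of-unity ray pool P_n that has exactly one zero coordinate belongs to any triad of P_n. -/
open Complex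

theorem zeta_pow_self {n : ℕ} (hn : 1 ≤ n) : zeta n ^ n = 1 := by
  have hn' : (n : ℂ) ≠ 0 := by exact_mod_cast (by omega : n ≠ 0)
  rw [zeta, ← Complex.exp_nat_mul, mul_div_cancel₀ _ hn', Complex.exp_two_pi_mul_I]

theorem add_ne_zero_of_pow_eq_one {n : ℕ} (hodd : Odd n) {a b : ℂ} (ha : a ^ n = 1)
    (hb : b ^ n = 1) : a + b ≠ 0 := by
  intro h
  rw [eq_neg_of_add_eq_zero_left h, hodd.neg_pow, hb] at ha
  norm_num at ha

/-- The representative of a pool ray is a nonzero multiple of a vector with coordinates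
zero or `n`-th roots of unity. -/
theorem exists_rep_eq_smul_of_mem_pool {n : ℕ} (hn : 1 ≤ n) {x : Ray3} (hx : x ∈ pool n) :
    ∃ (c : ℂ) (v : Fin 3 → ℂ), c ≠ 0 ∧ x.rep = c • v ∧ ∀ k, v k = 0 ∨ v k ^ n = 1 := by
  obtain ⟨v, hv, rfl, hroot⟩ := hx
  obtain ⟨a, ha⟩ := Projectivization.exists_smul_eq_mk_rep ℂ v hv
  refine ⟨a, v, a.ne_zero, ha.symm, fun k => (hroot k).imp_right ?_⟩
  rintro ⟨j, -, hj⟩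
  rw [hj, ← pow_mul, mul_comm, pow_mul, zeta_pow_self hn, one_pow]

theorem RayOrtho.symm {x y : Ray3} (h : RayOrtho x y) : RayOrtho y x := by
  have h' := congrArg (starRingEnd ℂ) h
  simpa [RayOrtho, hermInner, mul_comm] using h'

/-- A pool ray orthogonal to a pool ray whose only zero coordinate is `k` is the `k`-th
coordinate axis. -/
theorem rep_eq_zero_of_rayOrtho {n : ℕ} (hn : 1 ≤ n) (hodd : Odd n) {x y : Ray3}
    (hx : x ∈ pool n) (hy : y ∈ pool n) {k : Fin 3} (hk : ∀ j, x.rep j = 0 ↔ j = k)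
    (h : RayOrtho x y) : ∀ j, j ≠ k → y.rep j = 0 := by
  obtain ⟨c, v, hc, hxv, hv⟩ := exists_rep_eq_smul_of_mem_pool hn hx
  obtain ⟨d, w, hd, hyw, hw⟩ := exists_rep_eq_smul_of_mem_pool hn hy
  have hvk : ∀ j, v j = 0 ↔ j = k := fun j => by
    rw [← hk j, hxv, Pi.smul_apply, smul_eq_mul, mul_eq_zero, or_iff_right hc]
  have hsum : ∑ j, (starRingEnd ℂ) (v j) * w j = 0 := by
    have hcd : (starRingEnd ℂ) c * d ≠ 0 :=
      mul_ne_zero ((map_ne_zero _).2 hc) hd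
    refine (mul_eq_zero.1 ?_).resolve_left hcd
    rw [RayOrtho, hermInner, hxv, hyw] at h
    rw [← h, Finset.mul_sum]
    refine Finset.sum_congr rfl fun j _ => ?_
    simp only [Pi.smul_apply, smul_eq_mul, map_mul]
    ring
  have hterm : ∀ j, j ≠ k → w j ≠ 0 → ((starRingEnd ℂ) (v j) * w j) ^ n = 1 := by
    intro j hj hwj
    have hvj := (hv j).resolve_left (mt (hvk j).1 hj)
    rw [mul_pow, ← map_pow, hvj, map_one, (hw j).resolve_left hwj, one_mul]
  have hpair : ∀ i j, i ≠ k → j ≠ k →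
      (starRingEnd ℂ) (v i) * w i + (starRingEnd ℂ) (v j) * w j = 0 → w i = 0 ∧ w j = 0 := by
    intro i j hi hj hij
    have hvi : (starRingEnd ℂ) (v i) ≠ 0 := (map_ne_zero _).2 (mt (hvk i).1 hi)
    have hvj : (starRingEnd ℂ) (v j) ≠ 0 := (map_ne_zero _).2 (mt (hvk j).1 hj)
    by_cases hwi : w i = 0
    · simp_all
    by_cases hwj : w j = 0
    · simp_all
    exact absurd hij (add_ne_zero_of_pow_eq_one hodd (hterm i hi hwi) (hterm j hj hwj))
  have hw0 : ∀ j, j ≠ k → w j = 0 := by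
    have hk0 : v k = 0 := (hvk k).2 rfl
    rw [Fin.sum_univ_three] at hsum
    fin_cases k
    · have := hpair 1 2 (by decide) (by decide) (by simpa [show v 0 = 0 from hk0] using hsum)
      intro j hj
      fin_cases j <;> simp_all
    · have := hpair 0 2 (by decide) (by decide) (by simpa [show v 1 = 0 from hk0] using hsum)
      intro j hj
      fin_cases j <;> simp_all
    · have := hpair 0 1 (by decide) (by decide) (by simpa [show v 2 = 0 from hk0] using hsum)
      intro j hj
      fin_cases j <;> simp_all
  intro j hj
  rw [hyw, Pi.smul_apply, hw0 j hj, smul_zero]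

theorem eq_of_rep_eq_zero {y z : Ray3} {k : Fin 3} (hy : ∀ j, j ≠ k → y.rep j = 0)
    (hz : ∀ j, j ≠ k → z.rep j = 0) : y = z := by
  have hzk : z.rep k ≠ 0 := fun h => z.rep_nonzero <| funext fun j => by
    by_cases hj : j = k
    · rw [hj, h, Pi.zero_apply]
    · exact hz j hj
  rw [← y.mk_rep, ← z.mk_rep, Projectivization.mk_eq_mk_iff']
  refine ⟨y.rep k / z.rep k, funext fun j => ?_⟩
  by_cases hj : j = k
  · rw [hj, Pi.smul_apply, smul_eq_mul, div_mul_cancel₀ _ hzk]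
  · rw [Pi.smul_apply, hy j hj, hz j hj, smul_zero]

/-- One-zero isolation: for odd n, no ray of the pool with exactly one zero
coordinate belongs to any triad of the pool. -/
theorem stmt6 (n : ℕ) (hn : 1 ≤ n) (hodd : Odd n) (x : Ray3) (hx : x ∈ pool n)
    (hone : ∃ (v : Fin 3 → ℂ) (hv : v ≠ 0),
      Projectivization.mk ℂ v hv = x ∧ (∃! k : Fin 3, v k = 0)) :
    ¬ ∃ a b c : Ray3, a ∈ pool n ∧ b ∈ pool n ∧ c ∈ pool n ∧
      a ≠ b ∧ a ≠ c ∧ b ≠ c ∧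
      RayOrtho a b ∧ RayOrtho a c ∧ RayOrtho b c ∧
      (x = a ∨ x = b ∨ x = c) := by
  obtain ⟨v, hv, hvx, k, hk, huniq⟩ := hone
  have hxk : ∀ j, x.rep j = 0 ↔ j = k := fun j => by
    obtain ⟨a, ha⟩ := Projectivization.exists_smul_eq_mk_rep ℂ v hv
    rw [← hvx, ← ha, Pi.smul_apply, Units.smul_def, smul_eq_mul, mul_eq_zero,
      or_iff_right a.ne_zero]
    exact ⟨huniq j, fun h => h ▸ hk⟩
  have hcollapse : ∀ y ∈ pool n, ∀ z ∈ pool n, RayOrtho x y → RayOrtho x z → y = z :=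
    fun y hy z hz hxy hxz => eq_of_rep_eq_zero (rep_eq_zero_of_rayOrtho hn hodd hx hy hxk hxy)
      (rep_eq_zero_of_rayOrtho hn hodd hx hz hxk hxz)
  rintro ⟨a, b, c, ha, hb, hc, hab, hac, hbc, oab, oac, obc, rfl | rfl | rfl⟩
  · exact hbc (hcollapse b hb c hc oab oac)
  · exact hac (hcollapse a ha c hc oab.symm obc)
  · exact hab (hcollapse a ha b hb oac.symm obc.symm)
end

section
/- If n ≥ 1 is odd and divisible by 3, then the n-th root-of-unity ray pool P_n admits a KS coloring. -/
open Complex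

/-- A vanishing sum of three elements of `{0} ∪ {z | z ^ n = 1}` with `n` odd is either trivial or
a rotated copy of the three cube roots of unity. -/
lemma eq_zero_or_cubeRoots_of_add_eq_zero {n : ℕ} (hodd : Odd n) {u v w : ℂ}
    (hu : u = 0 ∨ u ^ n = 1) (hv : v = 0 ∨ v ^ n = 1) (hw : w = 0 ∨ w ^ n = 1)
    (h : u + v + w = 0) :
    (u = 0 ∧ v = 0 ∧ w = 0) ∨
      (u ≠ 0 ∧ v ≠ 0 ∧ w ≠ 0 ∧ u ^ 2 + u * v + v ^ 2 = 0) := by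
  have hn : n ≠ 0 := by rintro rfl; simp at hodd
  have opp : ∀ {a b : ℂ}, a ^ n = 1 → (b = 0 ∨ b ^ n = 1) → a + b ≠ 0 := by
    intro a b ha hb hab
    obtain rfl : a = -b := eq_neg_of_add_eq_zero_left hab
    rw [hodd.neg_pow] at ha
    rcases hb with rfl | hb
    · simp [hn] at ha
    · rw [hb] at ha
      norm_num at ha
  have conj_mul : ∀ {a : ℂ}, a ^ n = 1 → a * (starRingEnd ℂ) a = 1 := by
    intro a ha
    rw [Complex.mul_conj', Complex.norm_eq_one_of_pow_eq_one ha hn]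
    norm_num
  have ne : ∀ {a : ℂ}, a ^ n = 1 → a ≠ 0 := by
    rintro a ha rfl
    simp [hn] at ha
  rcases hu with rfl | hu
  · rcases hv with rfl | hv
    · left; simpa using h
    · exact absurd (by simpa using h) (opp hv hw)
  rcases hv with rfl | hv
  · exact absurd (by simpa using h) (opp hu hw)
  rcases hw with rfl | hw
  · exact absurd (by simpa using h) (opp hu (Or.inr hv))
  refine Or.inr ⟨ne hu, ne hv, ne hw, ?_⟩
  have hc := congrArg (starRingEnd ℂ) h
  simp only [map_add, map_zero] at hc
  have hu' := conj_mul hu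
  have hv' := conj_mul hv
  have hw' := conj_mul hw
  have e : v * w + u * w + u * v = 0 := by
    linear_combination (u * v * w) * hc - v * w * hu' - u * w * hv' - u * v * hw'
  linear_combination (u + v) * h - e

lemma exists_rep_of_mem_pool {n : ℕ} (hn : n ≠ 0) {x : Ray3} (hx : x ∈ pool n) :
    ∃ (c : ℂ) (v : Fin 3 → ℂ), c ≠ 0 ∧ (∀ k, x.rep k = c * v k) ∧
      ∀ k, v k = 0 ∨ v k ^ n = 1 := by
  obtain ⟨v, hv, rfl, h⟩ := hx
  obtain ⟨a, ha⟩ := Projectivization.exists_smul_eq_mk_rep ℂ v hv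
  refine ⟨a, v, a.ne_zero, fun k => by rw [← ha]; rfl, fun k => ?_⟩
  refine (h k).imp_right ?_
  rintro ⟨j, -, hj⟩
  rw [hj, ← pow_mul, mul_comm, pow_mul, zeta, (Complex.isPrimitiveRoot_exp n hn).pow_eq_one,
    one_pow]

/-- Orthogonal rays of an odd pool have disjoint supports, or both have full support and the ratios
of their first two coordinates differ by a primitive cube root of unity. -/
lemma disjoint_or_full_of_rayOrtho {n : ℕ} (hodd : Odd n) {x y : Ray3} (hx : x ∈ pool n)
    (hy : y ∈ pool n) (h : RayOrtho x y) :
    (∀ k, x.rep k = 0 ∨ y.rep k = 0) ∨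
      ((∀ k, x.rep k ≠ 0 ∧ y.rep k ≠ 0) ∧
        (x.rep 1 / x.rep 0) ^ 2 + (x.rep 1 / x.rep 0) * (y.rep 1 / y.rep 0) +
          (y.rep 1 / y.rep 0) ^ 2 = 0) := by
  have hn : n ≠ 0 := by rintro rfl; simp at hodd
  obtain ⟨c, v, hc, hv, hvn⟩ := exists_rep_of_mem_pool hn hx
  obtain ⟨d, w, hd, hw, hwn⟩ := exists_rep_of_mem_pool hn hy
  have hu : ∀ k, (starRingEnd ℂ) (v k) * w k = 0 ∨ ((starRingEnd ℂ) (v k) * w k) ^ n = 1 := by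
    intro k
    rcases hvn k with h1 | h1
    · simp [h1]
    rcases hwn k with h2 | h2
    · simp [h2]
    · right
      rw [mul_pow, ← map_pow, h1, h2]
      simp
  have hsum : (starRingEnd ℂ) (v 0) * w 0 + (starRingEnd ℂ) (v 1) * w 1 +
      (starRingEnd ℂ) (v 2) * w 2 = 0 := by
    have hcd : (starRingEnd ℂ) c * d ≠ 0 := mul_ne_zero (by simpa using hc) hd
    apply mul_left_cancel₀ hcd
    simp only [RayOrtho, hermInner, Fin.sum_univ_three, hv, hw, map_mul] at h
    linear_combination h
  rcases eq_zero_or_cubeRoots_of_add_eq_zero hodd (hu 0) (hu 1) (hu 2) hsum with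
    ⟨h0, h1, h2⟩ | ⟨h0, h1, h2, hq⟩
  · left
    simp only [mul_eq_zero, map_eq_zero] at h0 h1 h2
    intro k
    rw [hv, hw]
    fin_cases k <;> simp_all
  · right
    simp only [ne_eq, mul_eq_zero, map_eq_zero, not_or] at h0 h1 h2
    refine ⟨fun k => ?_, ?_⟩
    · rw [hv, hw]
      fin_cases k <;> simp_all
    · have conj_mul : ∀ k, v k ≠ 0 → v k * (starRingEnd ℂ) (v k) = 1 := by
        intro k hk
        rw [Complex.mul_conj',
          Complex.norm_eq_one_of_pow_eq_one ((hvn k).resolve_left hk) hn]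
        norm_num
      simp only [hv, hw, mul_div_mul_left _ _ hc, mul_div_mul_left _ _ hd]
      have e0 : (starRingEnd ℂ) (v 0) = (v 0)⁻¹ := eq_inv_of_mul_eq_one_right (conj_mul 0 h0.1)
      have e1 : (starRingEnd ℂ) (v 1) = (v 1)⁻¹ := eq_inv_of_mul_eq_one_right (conj_mul 1 h1.1)
      rw [e0, e1] at hq
      obtain ⟨hv0, hw0⟩ := h0
      obtain ⟨hv1, hw1⟩ := h1
      field_simp at hq ⊢
      linear_combination hq

/-- The colour of a vector: `e₀` is selected among vectors of non-full support, and a vector of full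
support is selected when the ratio of its first two coordinates is a principal cube root. -/
def Selected (v : Fin 3 → ℂ) : Prop :=
  (v 0 ≠ 0 ∧ v 1 = 0 ∧ v 2 = 0) ∨
    ((∀ k, v k ≠ 0) ∧ v 1 / v 0 = ((v 1 / v 0) ^ 3) ^ ((3 : ℕ) : ℂ)⁻¹)

lemma selected_iff_of_full {v : Fin 3 → ℂ} (h : ∀ k, v k ≠ 0) :
    Selected v ↔ v 1 / v 0 = ((v 1 / v 0) ^ 3) ^ ((3 : ℕ) : ℂ)⁻¹ := by
  simp [Selected, h]

lemma not_selected_of_selected {n : ℕ} (hodd : Odd n) {x y : Ray3} (hx : x ∈ pool n)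
    (hy : y ∈ pool n) (h : RayOrtho x y) (hs : Selected x.rep) : ¬ Selected y.rep := by
  rcases disjoint_or_full_of_rayOrtho hodd hx hy h with hd | ⟨hf, hq⟩
  · intro ht
    have hx0 : x.rep 0 ≠ 0 := hs.elim (·.1) (·.1 0)
    have hy0 : y.rep 0 ≠ 0 := ht.elim (·.1) (·.1 0)
    exact (hd 0).elim hx0 hy0
  · rw [selected_iff_of_full fun k => (hf k).1] at hs
    rw [selected_iff_of_full fun k => (hf k).2]
    intro ht
    have hne : x.rep 1 / x.rep 0 ≠ 0 := div_ne_zero (hf 1).1 (hf 0).1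
    generalize x.rep 1 / x.rep 0 = a at *
    generalize y.rep 1 / y.rep 0 = b at *
    have hcube : a ^ 3 = b ^ 3 := by linear_combination (a - b) * hq
    obtain rfl : a = b := by rw [hs, ht, hcube]
    apply hne
    have : 3 * a ^ 2 = 0 := by linear_combination hq
    simpa using this

lemma exists_selected_of_triad {n : ℕ} (hodd : Odd n) {x y z : Ray3} (hx : x ∈ pool n)
    (hy : y ∈ pool n) (hz : z ∈ pool n) (hxy : RayOrtho x y) (hxz : RayOrtho x z)
    (hyz : RayOrtho y z) : Selected x.rep ∨ Selected y.rep ∨ Selected z.rep := by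
  have nz : ∀ r : Ray3, ∃ k, r.rep k ≠ 0 := fun r => Function.ne_iff.mp r.rep_nonzero
  obtain ⟨i, hi⟩ := nz x
  obtain ⟨j, hj⟩ := nz y
  obtain ⟨k, hk⟩ := nz z
  rcases disjoint_or_full_of_rayOrtho hodd hx hy hxy with hd | ⟨hf, hq⟩
  · have hd' : ∀ k, x.rep k = 0 ∨ z.rep k = 0 :=
      (disjoint_or_full_of_rayOrtho hodd hx hz hxz).resolve_right fun hf =>
        (hd j).elim (hf.1 j).1 hj
    have hd'' : ∀ k, y.rep k = 0 ∨ z.rep k = 0 :=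
      (disjoint_or_full_of_rayOrtho hodd hy hz hyz).resolve_right fun hf =>
        (hd i).elim hi (hf.1 i).1
    have sel : ∀ r : Ray3, r.rep 0 ≠ 0 → r.rep 1 = 0 → r.rep 2 = 0 → Selected r.rep :=
      fun r h0 h1 h2 => Or.inl ⟨h0, h1, h2⟩
    have sx := sel x
    have sy := sel y
    have sz := sel z
    have d0 := hd 0
    have d1 := hd 1
    have d2 := hd 2
    have d0' := hd' 0
    have d1' := hd' 1
    have d2' := hd' 2
    have d0'' := hd'' 0
    have d1'' := hd'' 1
    have d2'' := hd'' 2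
    clear hd hd' hd'' nz sel
    fin_cases i <;> fin_cases j <;> fin_cases k <;> simp_all
  obtain ⟨hf', hq'⟩ := (disjoint_or_full_of_rayOrtho hodd hx hz hxz).resolve_left fun hd =>
    (hd k).elim (hf k).1 hk
  obtain ⟨hf'', hq''⟩ := (disjoint_or_full_of_rayOrtho hodd hy hz hyz).resolve_left fun hd =>
    (hd k).elim (hf k).2 hk
  rw [selected_iff_of_full fun k => (hf k).1, selected_iff_of_full fun k => (hf k).2,
    selected_iff_of_full fun k => (hf' k).2]
  have hne : y.rep 1 / y.rep 0 ≠ 0 := div_ne_zero (hf 1).2 (hf 0).2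
  generalize x.rep 1 / x.rep 0 = a at *
  generalize y.rep 1 / y.rep 0 = b at *
  generalize z.rep 1 / z.rep 0 = c at *
  have hbc : b - c ≠ 0 := by
    intro hbc
    obtain rfl : b = c := sub_eq_zero.mp hbc
    apply hne
    have : 3 * b ^ 2 = 0 := by linear_combination hq''
    simpa using this
  have hsum : a + b + c = 0 := by
    apply mul_left_cancel₀ hbc
    linear_combination hq - hq'
  have hb : b ^ 3 = a ^ 3 := by linear_combination (b - a) * hq
  have hc : c ^ 3 = a ^ 3 := by linear_combination (c - a) * hq'
  rw [hb, hc]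
  have hg : ((a ^ 3) ^ ((3 : ℕ) : ℂ)⁻¹) ^ 3 = a ^ 3 :=
    Complex.cpow_nat_inv_pow _ (by norm_num)
  generalize (a ^ 3) ^ ((3 : ℕ) : ℂ)⁻¹ = g at *
  have hprod : (a - g) * ((b - g) * (c - g)) = 0 := by
    obtain rfl : c = -a - b := by linear_combination hsum
    linear_combination -(a - g) * hq - hg
  simpa [sub_eq_zero] using hprod

/-- If n is odd and divisible by 3, the n-th root-of-unity ray pool admits a
KS coloring. -/
theorem stmt11 (n : ℕ) (hn : 1 ≤ n) (hodd : Odd n) (h3 : 3 ∣ n) :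
    ∃ f : Ray3 → Bool, IsKSColoring (pool n) f := by
  classical
  refine ⟨fun x => decide (Selected x.rep), fun v hv w hw h hs => ?_, ?_⟩
  · simp only [decide_eq_true_eq, decide_eq_false_iff_not] at hs ⊢
    exact not_selected_of_selected hodd hv hw h hs
  · intro a ha b hb c hc _ _ _ hab hac hbc
    have h := exists_selected_of_triad hodd ha hb hc hab hac hbc
    have h1 := not_selected_of_selected hodd ha hb hab
    have h2 := not_selected_of_selected hodd ha hc hac
    have h3 := not_selected_of_selected hodd hb hc hbc
    simp only [decide_eq_true_eq, decide_eq_false_iff_not]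
    tauto
end
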